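/- Let T = (V, E) be a finite tree, X = {X_1, ..., X_m} ⊆ V, and suppose each edge e ∈ E is assigned a nonzero parameter ρ'_e ∈ [−1, 1] \ {0}. For p ≠ q define ρ_pq = Π_{e ∈ ph_T(X_p, X_q)} ρ'_e. Then: (a) for any three distinct indices p, q, r, one has ρ_pq ρ_pr ρ_qr ≥ 0; (b) for any three distinct indices p, q, r, one has ρ_pq² ρ_qr² ≤ ρ_pr², ρ_pr² ρ_qr² ≤ ρ_pq², and ρ_pq² ρ_pr² ≤ ρ_qr²; (c) for any four distinct indices p, q, r, s with ph_T(X_p, X_q) ∩ ph_T(X_r, X_s) = ∅, one has ρ_pr² ρ_qs² ≤ ρ_pq² ρ_rs². -/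

import Mathlib

open SimpleGraph Finset

/-- The unique path between two vertices of a tree. -/
noncomputable def treePath {V : Type*} {G : SimpleGraph V} (hG : G.IsTree) (u v : V) :
    G.Walk u v :=
  (hG.existsUnique_path u v).choose

/-- `ph hG u v` is the set of edges lying on the unique path connecting `u` and `v` in the
tree `G`. -/
noncomputable def ph {V : Type*} [DecidableEq V] {G : SimpleGraph V} (hG : G.IsTree)
    (u v : V) : Finset (Sym2 V) :=
  (treePath hG u v).edges.toFinset

/-- The pseudometric induced by a tree with weight function `w` on its edges. -/
noncomputable def deltaW {V : Type*} [DecidableEq V] {G : SimpleGraph V} (hG : G.IsTree)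
    (w : Sym2 V → ℝ) (u v : V) : ℝ :=
  ∑ e ∈ ph hG u v, w e

theorem treePath_isPath {V : Type*} {G : SimpleGraph V} (hG : G.IsTree) (u v : V) :
    (treePath hG u v).IsPath :=
  (hG.existsUnique_path u v).choose_spec.1

theorem mem_ph_iff_not_reachable {V : Type*} [DecidableEq V] {G : SimpleGraph V}
    (hG : G.IsTree) (e : Sym2 V) (u v : V) :
    e ∈ ph hG u v ↔ ¬ (G.deleteEdges {e}).Reachable u v := by
  rw [ph, List.mem_toFinset]
  constructor
  · rintro he ⟨w⟩
    have hle : G.deleteEdges {e} ≤ G := deleteEdges_le _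
    have hpath : (w.toPath.1.mapLe hle).IsPath := w.toPath.2.mapLe hle
    have heq : treePath hG u v = w.toPath.1.mapLe hle :=
      (hG.existsUnique_path u v).unique (treePath_isPath hG u v) hpath
    rw [heq, Walk.edges_mapLe_eq_edges] at he
    have := w.toPath.1.edges_subset_edgeSet he
    simp [edgeSet_deleteEdges] at this
  · intro h
    by_contra he
    exact h ⟨(treePath hG u v).toDeleteEdge e he⟩

/-- Deleting one edge of a connected graph leaves every vertex joined to one of its ends. -/
theorem reachable_deleteEdges_or {V : Type*} {G : SimpleGraph V} {a b u v : V}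
    (w : G.Walk u v) (hv : v = a) :
    (G.deleteEdges {s(a, b)}).Reachable u a ∨ (G.deleteEdges {s(a, b)}).Reachable u b := by
  induction w with
  | nil => exact Or.inl (hv ▸ Reachable.refl _)
  | @cons x y z h p ih =>
    by_cases hxy : s(x, y) = s(a, b)
    · rcases Sym2.eq_iff.1 hxy with ⟨rfl, -⟩ | ⟨rfl, -⟩
      · exact Or.inl (Reachable.refl _)
      · exact Or.inr (Reachable.refl _)
    · have hadj : (G.deleteEdges {s(a, b)}).Adj x y := by
        rw [deleteEdges_adj]
        exact ⟨h, hxy⟩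
      exact (ih hv).imp hadj.reachable.trans hadj.reachable.trans

/-- An edge of a tree cuts the vertices into two sides, and lies on exactly the paths that join
different sides. -/
theorem exists_cut_mem_ph_iff {V : Type*} [DecidableEq V] {G : SimpleGraph V}
    (hG : G.IsTree) (e : Sym2 V) :
    ∃ S : V → Prop, ∀ u v, e ∈ ph hG u v ↔ ¬ (S u ↔ S v) := by
  induction e with
  | _ a b =>
    refine ⟨fun u => (G.deleteEdges {s(a, b)}).Reachable u a, fun u v => ?_⟩
    rw [mem_ph_iff_not_reachable, not_iff_not]
    refine ⟨fun h => ⟨h.symm.trans, h.trans⟩, fun h => ?_⟩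
    have hside (x : V) := reachable_deleteEdges_or (b := b) (hG.connected x a).some rfl
    by_cases hu : (G.deleteEdges {s(a, b)}).Reachable u a
    · exact hu.trans (h.1 hu).symm
    · exact ((hside u).resolve_left hu).trans ((hside v).resolve_left (mt h.2 hu)).symm

theorem prod_ph_eq_prod_edgeFinset {V : Type*} [DecidableEq V] {G : SimpleGraph V}
    [Fintype G.edgeSet] (hG : G.IsTree) {M : Type*} [CommMonoid M] (f : Sym2 V → M) (u v : V) :
    ∏ e ∈ ph hG u v, f e = ∏ e ∈ G.edgeFinset, if e ∈ ph hG u v then f e else 1 := by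
  rw [Finset.prod_ite_mem, Finset.inter_eq_right.2]
  intro e he
  exact mem_edgeFinset.2 ((treePath hG u v).edges_subset_edgeSet (List.mem_toFinset.1 he))

/-- Let `T` be a finite tree with observed nodes `X_1, …, X_m` and nonzero
edge parameters `ρ'_e ∈ [−1,1] \ {0}`; set `ρ_pq = ∏_{e ∈ ph(X_p, X_q)} ρ'_e`.  Then
(a) `ρ_pq ρ_pr ρ_qr ≥ 0` for distinct `p,q,r`; (b) `ρ_pq² ρ_qr² ≤ ρ_pr²`,
`ρ_pr² ρ_qr² ≤ ρ_pq²` and `ρ_pq² ρ_pr² ≤ ρ_qr²` for distinct `p,q,r`; and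
(c) `ρ_pr² ρ_qs² ≤ ρ_pq² ρ_rs²` for distinct `p,q,r,s` with
`ph(X_p,X_q) ∩ ph(X_r,X_s) = ∅`. -/
theorem stmt10 {V : Type*} [Fintype V] [DecidableEq V] {G : SimpleGraph V} (hG : G.IsTree)
    {m : ℕ} (X : Fin m → V) (hXinj : Function.Injective X)
    (ρ' : Sym2 V → ℝ) (hρ' : ∀ e ∈ G.edgeSet, ρ' e ∈ Set.Icc (-1 : ℝ) 1 ∧ ρ' e ≠ 0)
    (ρ : Fin m → Fin m → ℝ) (hρ : ∀ p q, ρ p q = ∏ e ∈ ph hG (X p) (X q), ρ' e) :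
    (∀ p q r : Fin m, p ≠ q → p ≠ r → q ≠ r → 0 ≤ ρ p q * ρ p r * ρ q r) ∧
      (∀ p q r : Fin m, p ≠ q → p ≠ r → q ≠ r →
        ρ p q ^ 2 * ρ q r ^ 2 ≤ ρ p r ^ 2 ∧
          ρ p r ^ 2 * ρ q r ^ 2 ≤ ρ p q ^ 2 ∧
          ρ p q ^ 2 * ρ p r ^ 2 ≤ ρ q r ^ 2) ∧
      (∀ p q r s : Fin m, p ≠ q → p ≠ r → p ≠ s → q ≠ r → q ≠ s → r ≠ s →
        ph hG (X p) (X q) ∩ ph hG (X r) (X s) = ∅ →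
        ρ p r ^ 2 * ρ q s ^ 2 ≤ ρ p q ^ 2 * ρ r s ^ 2) := by
  classical
  simp only [hρ, prod_ph_eq_prod_edgeFinset, ← Finset.prod_pow, ← Finset.prod_mul_distrib]
  have hsq (e : Sym2 V) (he : e ∈ G.edgeFinset) : ρ' e ^ 2 ≤ 1 := by
    obtain ⟨⟨h₁, h₂⟩, -⟩ := hρ' e (mem_edgeFinset.1 he)
    exact (sq_le_one_iff_abs_le_one _).2 (abs_le.2 ⟨h₁, h₂⟩)
  have hmul (e : Sym2 V) (he : e ∈ G.edgeFinset) : ρ' e ^ 2 * ρ' e ^ 2 ≤ 1 :=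
    mul_le_one₀ (hsq e he) (sq_nonneg _) (hsq e he)
  have htriple (p q r : Fin m) :
      (∏ e ∈ G.edgeFinset, ((if e ∈ ph hG (X p) (X q) then ρ' e else 1) ^ 2 *
        (if e ∈ ph hG (X q) (X r) then ρ' e else 1) ^ 2)) ≤
      ∏ e ∈ G.edgeFinset, (if e ∈ ph hG (X p) (X r) then ρ' e else 1) ^ 2 := by
    refine Finset.prod_le_prod (fun e _ => by positivity) fun e he => ?_
    obtain ⟨S, hS⟩ := exists_cut_mem_ph_iff hG e
    have h₂ := hmul e he
    simp only [hS]
    by_cases hp : S (X p) <;> by_cases hq : S (X q) <;> by_cases hr : S (X r) <;>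
      simp [hp, hq, hr, h₂]
  have hcomm (p q : Fin m) : ph hG (X p) (X q) = ph hG (X q) (X p) := by
    ext e
    rw [mem_ph_iff_not_reachable, mem_ph_iff_not_reachable, reachable_comm]
  refine ⟨fun p q r _ _ _ => ?_, fun p q r _ _ _ => ⟨htriple p q r, ?_, ?_⟩,
    fun p q r s _ _ _ _ _ _ hdisj => ?_⟩
  · refine Finset.prod_nonneg fun e he => ?_
    obtain ⟨S, hS⟩ := exists_cut_mem_ph_iff hG e
    simp only [hS]
    by_cases hp : S (X p) <;> by_cases hq : S (X q) <;> by_cases hr : S (X r) <;>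
      simp [hp, hq, hr, mul_self_nonneg]
  · simpa only [hcomm r q] using htriple p r q
  · simpa only [hcomm q p] using htriple q p r
  · refine Finset.prod_le_prod (fun e _ => by positivity) fun e he => ?_
    have hnot : ¬ (e ∈ ph hG (X p) (X q) ∧ e ∈ ph hG (X r) (X s)) := by
      rw [← Finset.mem_inter, hdisj]
      exact Finset.notMem_empty e
    obtain ⟨S, hS⟩ := exists_cut_mem_ph_iff hG e
    have h₂ := hmul e he
    simp only [hS] at hnot ⊢
    by_cases hp : S (X p) <;> by_cases hq : S (X q) <;> by_cases hr : S (X r) <;>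
      by_cases hs : S (X s) <;> simp_all
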